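/- For Re(b) > 0, Re(d) > 0, Re(s) > 0, and b ≠ 1, ∫₀^∞ e^{-st} t^{b-1} ₂F₂(a, d+1; 2+a-b, d; -st) dt = [s^{-b} Γ(1/2) Γ(b) Γ(2+a-b) / (2^a (1-b))] · { ((1+a-b)/d - 1) / (Γ(a/2) Γ(a/2 - b + 3/2)) + (1 - a/d) / (Γ((a+1)/2) Γ(1 + a/2 - b)) }. -/

import Mathlib

open Complex Set MeasureTheory

/-- Pochhammer symbol `(a)_n` on the complex numbers. -/
noncomputable def poch (a : ℂ) (n : ℕ) : ℂ := (ascPochhammer ℂ n).eval a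

/-- Generalized hypergeometric series with numerator parameters `as` and
denominator parameters `bs`, evaluated at `z`. -/
noncomputable def hyp (as bs : List ℂ) (z : ℂ) : ℂ :=
  ∑' n : ℕ, ((as.map fun a => poch a n).prod /
    ((bs.map fun b => poch b n).prod * (n.factorial : ℂ))) * z ^ n


theorem poch_succ (a : ℂ) (n : ℕ) : poch a (n + 1) = poch a n * (a + n) :=
  ascPochhammer_succ_eval n a

theorem poch_mul_add (a : ℂ) (n : ℕ) : poch a n * (a + n) = a * poch (a + 1) n := by
  rw [← poch_succ, poch, poch, ascPochhammer_succ_left]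
  simp

theorem Gamma_mul_poch_eq (c : ℂ) (hc : ∀ n : ℕ, c ≠ -(n : ℂ)) (n : ℕ) :
    Complex.Gamma (c + n) = Complex.Gamma c * poch c n := by
  induction n with
  | zero => simp [poch]
  | succ n ih =>
    have h : c + n ≠ 0 := fun h => hc n (eq_neg_of_add_eq_zero_left h)
    rw [poch_succ, Nat.cast_succ, ← add_assoc, Complex.Gamma_add_one _ h, ih]
    ring

/-- Taylor coefficients of the regularized confluent hypergeometric function. -/
noncomputable def kummerCoeff (a c : ℂ) (n : ℕ) : ℂ :=
  poch a n * (Complex.Gamma (c + n))⁻¹ / (n.factorial : ℂ)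

/-- The regularized confluent hypergeometric function `₁F₁(a; c; z) / Γ(c)`. -/
noncomputable def kummerM (a c z : ℂ) : ℂ := ∑' n : ℕ, kummerCoeff a c n * z ^ n

theorem kummerCoeff_succ (a c : ℂ) (n : ℕ) :
    kummerCoeff a c (n + 1) * ((n + 1) * (c + n)) = (a + n) * kummerCoeff a c n := by
  have hn : (n : ℂ) + 1 ≠ 0 := Nat.cast_add_one_ne_zero n
  have hf : (n.factorial : ℂ) ≠ 0 := Nat.cast_ne_zero.mpr n.factorial_ne_zero
  simp only [kummerCoeff, poch_succ, Nat.factorial_succ, Nat.cast_mul, Nat.cast_succ]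
  rw [Complex.one_div_Gamma_eq_self_mul_one_div_Gamma_add_one (c + n), ← add_assoc]
  field_simp

theorem succ_mul_kummerCoeff_succ (a c : ℂ) (n : ℕ) :
    (n + 1) * kummerCoeff a c (n + 1) = a * kummerCoeff (a + 1) (c + 1) n := by
  have hn : (n : ℂ) + 1 ≠ 0 := Nat.cast_add_one_ne_zero n
  have hf : (n.factorial : ℂ) ≠ 0 := Nat.cast_ne_zero.mpr n.factorial_ne_zero
  simp only [kummerCoeff, poch_succ, poch_mul_add, Nat.factorial_succ, Nat.cast_mul, Nat.cast_succ]
  rw [show c + ((n : ℂ) + 1) = c + 1 + n by ring]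
  field_simp

theorem summable_norm_kummerCoeff (a c : ℂ) {R : ℝ} (hR : 0 ≤ R) :
    Summable fun n : ℕ => ‖kummerCoeff a c n‖ * R ^ n := by
  refine summable_of_ratio_norm_eventually_le (r := 1 / 2) (by norm_num) ?_
  filter_upwards [Filter.eventually_ge_atTop (⌈2 * ‖c‖ + ‖a‖ + 8 * R + 1⌉₊)] with n hn
  have hn' : 2 * ‖c‖ + ‖a‖ + 8 * R + 1 ≤ n := (Nat.le_ceil _).trans (by exact_mod_cast hn)
  have h1 : (n : ℝ) / 2 ≤ ‖c + n‖ := by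
    have := norm_sub_norm_le (n : ℂ) (-c)
    rw [norm_neg, sub_neg_eq_add, add_comm, Complex.norm_natCast] at this
    rw [add_comm] at this
    have := norm_nonneg a
    rw [add_comm c]
    linarith
  have h2 : ‖a + n‖ ≤ 2 * n := by
    have := norm_add_le a n
    rw [Complex.norm_natCast] at this
    have := norm_nonneg c
    linarith
  have hn1 : (0 : ℝ) < n + 1 := by positivity
  have hn0 : (0 : ℝ) < n := by
    have := norm_nonneg a
    have := norm_nonneg c
    linarith
  have key := congrArg norm (kummerCoeff_succ a c n)
  rw [norm_mul, norm_mul, norm_mul, show ‖(n : ℂ) + 1‖ = (n : ℝ) + 1 by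
    exact_mod_cast Complex.norm_natCast (n + 1)] at key
  simp only [norm_mul, norm_norm, norm_pow, Real.norm_of_nonneg hR]
  set k := ‖kummerCoeff a c n‖
  set k' := ‖kummerCoeff a c (n + 1)‖
  have hk' : 0 ≤ k' := norm_nonneg _
  have hk : 0 ≤ k := norm_nonneg _
  have h3 : k' * (n * (n / 2)) ≤ 2 * n * k := by
    calc k' * (n * (n / 2)) ≤ k' * ((n + 1) * ‖c + n‖) := by gcongr; linarith
      _ = ‖a + n‖ * k := key
      _ ≤ 2 * n * k := by gcongr
  have h4 : k' * n ≤ 4 * k := by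
    refine le_of_mul_le_mul_right ?_ hn0
    nlinarith
  have h5 : k' * R ≤ 1 / 2 * k := by
    have : 8 * R ≤ n := by
      have := norm_nonneg a
      have := norm_nonneg c
      linarith
    nlinarith
  calc k' * R ^ (n + 1) = k' * R * R ^ n := by ring
    _ ≤ 1 / 2 * k * R ^ n := by gcongr
    _ = _ := by ring

theorem summable_kummerM (a c z : ℂ) : Summable fun n : ℕ => kummerCoeff a c n * z ^ n := by
  refine Summable.of_norm ?_
  simpa using summable_norm_kummerCoeff a c (norm_nonneg z)

theorem hasDerivAt_kummerM (a c z : ℂ) :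
    HasDerivAt (kummerM a c) (a * kummerM (a + 1) (c + 1) z) z := by
  have hU : IsOpen (Metric.ball (0 : ℂ) (‖z‖ + 1)) := Metric.isOpen_ball
  have hz : z ∈ Metric.ball (0 : ℂ) (‖z‖ + 1) := by simp
  have hs := summable_norm_kummerCoeff a c (R := ‖z‖ + 1) (by positivity)
  have hd : ∀ n : ℕ, DifferentiableOn ℂ (fun w : ℂ => kummerCoeff a c n * w ^ n)
      (Metric.ball (0 : ℂ) (‖z‖ + 1)) := fun n => by fun_prop
  have hb : ∀ (n : ℕ) (w : ℂ), w ∈ Metric.ball (0 : ℂ) (‖z‖ + 1) →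
      ‖kummerCoeff a c n * w ^ n‖ ≤ ‖kummerCoeff a c n‖ * (‖z‖ + 1) ^ n := fun n w hw => by
    rw [norm_mul, norm_pow]
    have : ‖w‖ ≤ ‖z‖ + 1 := by simpa using (mem_ball_zero_iff.mp hw).le
    gcongr
  have h1 := (Complex.differentiableOn_tsum_of_summable_norm hs hd hU hb).differentiableAt
    (hU.mem_nhds hz)
  have h2 := Complex.hasSum_deriv_of_summable_norm hs hd hU hb hz
  have h3 : deriv (fun w : ℂ => ∑' n : ℕ, kummerCoeff a c n * w ^ n) z
      = a * kummerM (a + 1) (c + 1) z := by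
    refine h2.unique ?_
    rw [← hasSum_nat_add_iff' 1]
    simp only [Finset.range_one, Finset.sum_singleton, pow_zero, mul_one, deriv_const, sub_zero]
    convert! (summable_kummerM (a + 1) (c + 1) z).hasSum.mul_left a using 1
    funext n
    rw [← mul_assoc, ← succ_mul_kummerCoeff_succ]
    simp
    ring
  rw [← h3]
  exact h1.hasDerivAt

theorem continuous_kummerM (a c : ℂ) : Continuous (kummerM a c) :=
  continuous_iff_continuousAt.mpr fun z => (hasDerivAt_kummerM a c z).continuousAt

theorem kummerM_eq_of_coeff {a c z A B : ℂ} {a₁ c₁ a₂ c₂ : ℂ}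
    (h0 : kummerCoeff a c 0 = A * kummerCoeff a₁ c₁ 0)
    (h : ∀ n : ℕ, kummerCoeff a c (n + 1) =
      A * kummerCoeff a₁ c₁ (n + 1) + B * kummerCoeff a₂ c₂ n) :
    kummerM a c z = A * kummerM a₁ c₁ z + B * z * kummerM a₂ c₂ z := by
  rw [kummerM, kummerM, kummerM, (summable_kummerM a c z).tsum_eq_zero_add,
    (summable_kummerM a₁ c₁ z).tsum_eq_zero_add, mul_add, ← tsum_mul_left, ← tsum_mul_left,
    add_assoc, ← Summable.tsum_add, h0]
  · simp only [h]
    congr 1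
    · ring
    · congr 1
      funext n
      ring
  · exact ((summable_nat_add_iff 1).mpr (summable_kummerM a₁ c₁ z)).mul_left A
  · exact (summable_kummerM a₂ c₂ z).mul_left _

theorem kummerM_raise_num (a c z : ℂ) :
    kummerM a c z = kummerM (a + 1) c z - z * kummerM (a + 1) (c + 1) z := by
  have := kummerM_eq_of_coeff (a := a) (c := c) (z := z) (A := 1) (B := -1) (a₁ := a + 1)
    (c₁ := c) (a₂ := a + 1) (c₂ := c + 1) (by simp [kummerCoeff, poch]) fun n => by
      have hf : (n.factorial : ℂ) ≠ 0 := Nat.cast_ne_zero.mpr n.factorial_ne_zero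
      have hn : (n : ℂ) + 1 ≠ 0 := Nat.cast_add_one_ne_zero n
      simp only [kummerCoeff, poch_succ, Nat.factorial_succ, Nat.cast_mul, Nat.cast_succ]
      rw [poch_mul_add, show c + ((n : ℂ) + 1) = c + 1 + n by ring]
      field_simp
      ring
  rw [this]
  ring

theorem kummerM_raise_den (a c z : ℂ) :
    kummerM a c z = c * kummerM a (c + 1) z + a * z * kummerM (a + 1) (c + 2) z :=
  kummerM_eq_of_coeff (by
    have := Complex.one_div_Gamma_eq_self_mul_one_div_Gamma_add_one c
    simp [kummerCoeff, poch, this]) fun n => by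
      have hf : (n.factorial : ℂ) ≠ 0 := Nat.cast_ne_zero.mpr n.factorial_ne_zero
      have hn : (n : ℂ) + 1 ≠ 0 := Nat.cast_add_one_ne_zero n
      have h := Complex.one_div_Gamma_eq_self_mul_one_div_Gamma_add_one (c + 1 + n)
      simp only [kummerCoeff, poch_succ, poch_mul_add, Nat.factorial_succ, Nat.cast_mul,
        Nat.cast_succ]
      rw [show c + ((n : ℂ) + 1) = c + 1 + n by ring,
        show c + 1 + ((n : ℂ) + 1) = c + 1 + n + 1 by ring,
        show c + 2 + (n : ℂ) = c + 1 + n + 1 by ring, h]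
      field_simp
      ring

theorem kummerM_raise_both (a c z : ℂ) :
    kummerM a c z =
      (a + 1) * z * kummerM (a + 2) (c + 2) z + (c - z) * kummerM (a + 1) (c + 1) z := by
  rw [kummerM_raise_num, kummerM_raise_den (a + 1) c, show a + 1 + 1 = a + 2 by ring]
  ring

theorem kummerM_contiguous (a c z : ℂ) :
    (c - a) * kummerM a (c + 1) z = kummerM a c z - a * kummerM (a + 1) (c + 1) z := by
  have h := kummerM_raise_num a (c + 1) z
  rw [show c + 1 + 1 = c + 2 by ring] at h
  linear_combination -kummerM_raise_den a c z - a * h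

/-- Polynomial boundedness on the closed left half-plane. -/
def PolyBdd (f : ℂ → ℂ) : Prop :=
  ∃ (C : ℝ) (N : ℕ), ∀ z : ℂ, z.re ≤ 0 → ‖f z‖ ≤ C * (1 + ‖z‖) ^ N

namespace PolyBdd

theorem const (k : ℂ) : PolyBdd fun _ => k := ⟨‖k‖, 0, fun z _ => by simp⟩

theorem id : PolyBdd fun z => z := ⟨1, 1, fun z _ => by simp⟩

theorem mul {f g : ℂ → ℂ} (hf : PolyBdd f) (hg : PolyBdd g) : PolyBdd fun z => f z * g z := by
  obtain ⟨C, N, hC⟩ := hf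
  obtain ⟨D, K, hD⟩ := hg
  refine ⟨C * D, N + K, fun z hz => ?_⟩
  calc ‖f z * g z‖ = ‖f z‖ * ‖g z‖ := norm_mul _ _
    _ ≤ (C * (1 + ‖z‖) ^ N) * (D * (1 + ‖z‖) ^ K) :=
      mul_le_mul (hC z hz) (hD z hz) (norm_nonneg _) ((norm_nonneg _).trans (hC z hz))
    _ = C * D * (1 + ‖z‖) ^ (N + K) := by ring

theorem add {f g : ℂ → ℂ} (hf : PolyBdd f) (hg : PolyBdd g) : PolyBdd fun z => f z + g z := by
  obtain ⟨C, N, hC⟩ := hf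
  obtain ⟨D, K, hD⟩ := hg
  have hC0 : 0 ≤ C := by simpa using (norm_nonneg _).trans (hC 0 (by simp))
  have hD0 : 0 ≤ D := by simpa using (norm_nonneg _).trans (hD 0 (by simp))
  refine ⟨C + D, N + K, fun z hz => ?_⟩
  have h1 : (1 : ℝ) ≤ 1 + ‖z‖ := by simp
  calc ‖f z + g z‖ ≤ ‖f z‖ + ‖g z‖ := norm_add_le _ _
    _ ≤ C * (1 + ‖z‖) ^ N + D * (1 + ‖z‖) ^ K := add_le_add (hC z hz) (hD z hz)
    _ ≤ C * (1 + ‖z‖) ^ (N + K) + D * (1 + ‖z‖) ^ (N + K) := by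
      gcongr <;> first | exact h1 | omega
    _ = (C + D) * (1 + ‖z‖) ^ (N + K) := by ring

end PolyBdd

theorem integrableOn_laplace_rpow {β σ : ℝ} (hβ : 0 < β) (hσ : 0 < σ) :
    IntegrableOn (fun t : ℝ => t ^ (β - 1) * Real.exp (-σ * t)) (Ioi 0) := by
  simpa using integrableOn_rpow_mul_exp_neg_mul_rpow (s := β - 1) (p := 1) (b := σ)
    (by linarith) one_pos hσ

theorem norm_laplace_kernel {b s : ℂ} {t : ℝ} (ht : 0 < t) :
    ‖Complex.exp (-(s * t)) * (t : ℂ) ^ (b - 1)‖ = t ^ (b.re - 1) * Real.exp (-s.re * t) := by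
  rw [norm_mul, Complex.norm_exp, Complex.norm_cpow_eq_rpow_re_of_pos ht, mul_comm]
  simp

theorem measurable_laplace_kernel (b s : ℂ) :
    Measurable fun t : ℝ => Complex.exp (-(s * t)) * (t : ℂ) ^ (b - 1) := by
  fun_prop

theorem integrableOn_laplace {b s : ℂ} (hb : 0 < b.re) (hs : 0 < s.re) {f : ℂ → ℂ}
    (hf : Continuous f) (hP : PolyBdd f) :
    IntegrableOn (fun t : ℝ => Complex.exp (-(s * t)) * (t : ℂ) ^ (b - 1) * f (-(s * t)))
      (Ioi 0) := by
  obtain ⟨C, N, hC⟩ := hP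
  have hC0 : 0 ≤ C := by simpa using (norm_nonneg _).trans (hC 0 (by simp))
  set σ := s.re / 2 with hσd
  have hσ : 0 < σ := by positivity
  set K := C * (1 + ‖s‖) ^ N * (N.factorial / σ ^ N * Real.exp σ) with hK
  refine Integrable.mono' ((integrableOn_laplace_rpow hb hσ).const_mul K) ?_ ?_
  · exact ((measurable_laplace_kernel b s).mul (hf.measurable.comp (by fun_prop)))
      |>.aestronglyMeasurable
  · filter_upwards [ae_restrict_mem measurableSet_Ioi] with t ht
    have ht : 0 < t := ht
    have h1 := hC (-(s * t)) (by simp; positivity)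
    have h2 : (1 + t) ^ N ≤ N.factorial / σ ^ N * Real.exp σ * Real.exp (σ * t) := by
      have := Real.pow_div_factorial_le_exp (x := σ * (1 + t)) (by positivity) N
      rw [div_le_iff₀ (by positivity), mul_pow, mul_add, Real.exp_add, mul_one] at this
      rw [div_mul_eq_mul_div, div_mul_eq_mul_div, le_div_iff₀ (by positivity)]
      linarith
    have h3 : (1 + ‖-(s * t)‖) ^ N ≤ (1 + ‖s‖) ^ N * (1 + t) ^ N := by
      rw [← mul_pow]
      gcongr
      rw [norm_neg, norm_mul, Complex.norm_of_nonneg ht.le]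
      nlinarith [norm_nonneg s]
    rw [norm_mul, norm_laplace_kernel ht]
    calc t ^ (b.re - 1) * Real.exp (-s.re * t) * ‖f (-(s * t))‖
        ≤ t ^ (b.re - 1) * Real.exp (-s.re * t) * (C * ((1 + ‖s‖) ^ N *
          (N.factorial / σ ^ N * Real.exp σ * Real.exp (σ * t)))) := by
          gcongr
          refine h1.trans ?_
          gcongr
          refine h3.trans ?_
          gcongr
      _ = K * (t ^ (b.re - 1) * (Real.exp (-s.re * t) * Real.exp (σ * t))) := by
          rw [hK]; ring
      _ = K * (t ^ (b.re - 1) * Real.exp (-σ * t)) := by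
          rw [← Real.exp_add]
          congr 3
          rw [hσd]; ring

/-- The Laplace-type transform `∫₀^∞ e^{-st} t^{b-1} f(-st) dt`. -/
noncomputable def laplaceT (b s : ℂ) (f : ℂ → ℂ) : ℂ :=
  ∫ t in Ioi (0 : ℝ), Complex.exp (-(s * t)) * (t : ℂ) ^ (b - 1) * f (-(s * t))

theorem laplaceT_lin {b s : ℂ} (hb : 0 < b.re) (hs : 0 < s.re) {f g : ℂ → ℂ} (p q : ℂ)
    (hf : Continuous f) (hfP : PolyBdd f) (hg : Continuous g) (hgP : PolyBdd g) :
    laplaceT b s (fun w => p * f w + q * g w) = p * laplaceT b s f + q * laplaceT b s g := by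
  rw [laplaceT, laplaceT, laplaceT, ← integral_const_mul, ← integral_const_mul, ← integral_add]
  · congr 1
    funext t
    ring
  · exact (integrableOn_laplace hb hs hf hfP).const_mul p
  · exact (integrableOn_laplace hb hs hg hgP).const_mul q

theorem laplaceT_id_mul (b s : ℂ) (f : ℂ → ℂ) :
    laplaceT b s (fun w => w * f w) = -s * laplaceT (b + 1) s f := by
  rw [laplaceT, laplaceT, ← integral_const_mul]
  refine setIntegral_congr_fun measurableSet_Ioi fun t ht => ?_
  have ht : (t : ℂ) ≠ 0 := by exact_mod_cast (ne_of_gt ht)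
  rw [show b + 1 - 1 = b - 1 + 1 by ring, Complex.cpow_add _ _ ht, Complex.cpow_one]
  ring

theorem laplaceT_deriv {b s : ℂ} (hb : 0 < b.re) (hs : 0 < s.re) {f f' : ℂ → ℂ}
    (hd : ∀ z, HasDerivAt f (f' z) z) (hfP : PolyBdd f) (hf' : Continuous f')
    (hfP' : PolyBdd f') :
    laplaceT b s (fun w => (b + w) * f w + w * f' w) = 0 := by
  have hf : Continuous f := continuous_iff_continuousAt.mpr fun z => (hd z).continuousAt
  have hb0 : b ≠ 0 := fun h => by simp [h] at hb
  have hI : IntegrableOn (fun t : ℝ => Complex.exp (-(s * t)) * (t : ℂ) ^ (b - 1) *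
      ((b + -(s * t)) * f (-(s * t)) + -(s * t) * f' (-(s * t)))) (Ioi 0) :=
    integrableOn_laplace hb hs (f := fun w => (b + w) * f w + w * f' w) (by fun_prop)
      ((((PolyBdd.const b).add PolyBdd.id).mul hfP).add (PolyBdd.id.mul hfP'))
  have hder : ∀ t ∈ Ioi (0 : ℝ), HasDerivAt
      (fun t : ℝ => Complex.exp (-(s * t)) * (t : ℂ) ^ b * f (-(s * t)))
      (Complex.exp (-(s * t)) * (t : ℂ) ^ (b - 1) *
        ((b + -(s * t)) * f (-(s * t)) + -(s * t) * f' (-(s * t)))) t := fun t ht => by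
    have ht0 : t ≠ 0 := ne_of_gt ht
    have htc : (t : ℂ) ≠ 0 := by exact_mod_cast ht0
    have h1 : HasDerivAt (fun t : ℝ => -(s * (t : ℂ))) (-(s * 1)) t :=
      ((Complex.ofRealCLM.hasDerivAt).const_mul s).neg
    have h2 := h1.cexp
    have h3 := hasDerivAt_ofReal_cpow_const ht0 hb0
    have h4 : HasDerivAt (fun t : ℝ => f (-(s * t))) (f' (-(s * t)) * (-(s * 1))) t :=
      (hd _).comp t h1
    refine ((h2.mul h3).mul h4).congr_deriv ?_
    simp only [Pi.mul_apply]
    rw [show (t : ℂ) ^ b = (t : ℂ) ^ (b - 1) * t by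
      rw [Complex.cpow_sub _ _ htc, Complex.cpow_one, div_mul_cancel₀ _ htc]]
    ring
  have hI2 : IntegrableOn (fun t : ℝ => Complex.exp (-(s * t)) * (t : ℂ) ^ b * f (-(s * t)))
      (Ioi 0) := by
    simpa using integrableOn_laplace (b := b + 1) (by simp; linarith) hs hf hfP
  have hlim := tendsto_zero_of_hasDerivAt_of_integrableOn_Ioi hder hI hI2
  have hc : ContinuousWithinAt
      (fun t : ℝ => Complex.exp (-(s * t)) * (t : ℂ) ^ b * f (-(s * t))) (Ici 0) 0 := by
    refine ContinuousAt.continuousWithinAt ?_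
    refine ContinuousAt.mul (ContinuousAt.mul (by fun_prop) ?_) (by fun_prop)
    exact Complex.continuousAt_ofReal_cpow_const _ _ (Or.inl hb)
  have := integral_Ioi_of_hasDerivAt_of_tendsto hc hder hI hlim
  rw [laplaceT, this]
  simp [hb0]

theorem integrableOn_beta_kernel {p q : ℂ} (hp : 0 < p.re) (hq : 0 < q.re) :
    IntegrableOn (fun u : ℝ => (u : ℂ) ^ (p - 1) * (1 - (u : ℂ)) ^ (q - 1)) (Ioc 0 1) :=
  (intervalIntegrable_iff_integrableOn_Ioc_of_le zero_le_one).mp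
    (Complex.betaIntegral_convergent hp hq)

theorem integrableOn_beta_kernel_mul {p q : ℂ} (hp : 0 < p.re) (hq : 0 < q.re) {g : ℝ → ℂ}
    (hg : ContinuousOn g (Icc 0 1)) :
    IntegrableOn (fun u : ℝ => (u : ℂ) ^ (p - 1) * (1 - (u : ℂ)) ^ (q - 1) * g u) (Ioc 0 1) := by
  obtain ⟨C, hC⟩ := isCompact_Icc.exists_bound_of_continuousOn hg
  refine Integrable.mul_bdd (c := C) (integrableOn_beta_kernel hp hq) ?_ ?_
  · exact (hg.mono Ioc_subset_Icc_self).aestronglyMeasurable measurableSet_Ioc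
  · filter_upwards [ae_restrict_mem measurableSet_Ioc] with u hu
    exact hC u (Ioc_subset_Icc_self hu)

theorem integral_beta_kernel_mul_pow {p q : ℂ} (hp : 0 < p.re) (hq : 0 < q.re) (n : ℕ) :
    ∫ u in Ioc (0 : ℝ) 1, (u : ℂ) ^ (p - 1) * (1 - (u : ℂ)) ^ (q - 1) * (u : ℂ) ^ n =
      Complex.Gamma p * Complex.Gamma q * (poch p n * (Complex.Gamma (p + q + n))⁻¹) := by
  have hpn : 0 < (p + n).re := by simp; positivity
  have h0 : ∀ n : ℕ, p ≠ -(n : ℂ) := fun n h => by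
    rw [h] at hp
    simp at hp
    linarith [(Nat.cast_nonneg n : (0 : ℝ) ≤ n)]
  calc _ = Complex.betaIntegral (p + n) q := by
        rw [Complex.betaIntegral, intervalIntegral.integral_of_le zero_le_one]
        refine setIntegral_congr_fun measurableSet_Ioc fun u hu => ?_
        have hu : (u : ℂ) ≠ 0 := by exact_mod_cast (ne_of_gt hu.1)
        rw [show p + n - 1 = p - 1 + n by ring, Complex.cpow_add _ _ hu, Complex.cpow_natCast]
        ring
    _ = _ := by
        rw [Complex.betaIntegral_eq_Gamma_mul_div _ _ hpn hq, Gamma_mul_poch_eq p h0,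
          show p + n + q = p + q + n by ring]
        ring

theorem integral_beta_kernel_mul_exp {p q : ℂ} (hp : 0 < p.re) (hq : 0 < q.re) (z : ℂ) :
    ∫ u in Ioc (0 : ℝ) 1, (u : ℂ) ^ (p - 1) * (1 - (u : ℂ)) ^ (q - 1) * Complex.exp (z * u) =
      Complex.Gamma p * Complex.Gamma q * kummerM p (p + q) z := by
  set F : ℕ → ℝ → ℂ := fun n u =>
    (u : ℂ) ^ (p - 1) * (1 - (u : ℂ)) ^ (q - 1) * ((z * u) ^ n / n.factorial) with hF
  have hint : ∀ n, Integrable (F n) (volume.restrict (Ioc 0 1)) := fun n =>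
    integrableOn_beta_kernel_mul hp hq (by fun_prop)
  have hk := integrableOn_beta_kernel hp hq
  have hsum : Summable fun n => ∫ u in Ioc (0 : ℝ) 1, ‖F n u‖ := by
    refine Summable.of_nonneg_of_le (fun n => integral_nonneg fun u => norm_nonneg _) (fun n => ?_)
      ((Real.summable_pow_div_factorial ‖z‖).mul_left
        (∫ u in Ioc (0 : ℝ) 1, ‖(u : ℂ) ^ (p - 1) * (1 - (u : ℂ)) ^ (q - 1)‖))
    rw [← integral_mul_const]
    refine setIntegral_mono_on (hint n).norm (hk.norm.mul_const _) measurableSet_Ioc fun u hu => ?_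
    rw [hF, norm_mul, norm_div, norm_pow, norm_mul z, Complex.norm_natCast,
      Complex.norm_of_nonneg hu.1.le]
    gcongr
    · exact mul_nonneg (norm_nonneg z) hu.1.le
    · exact mul_le_of_le_one_right (norm_nonneg z) hu.2
  have h := hasSum_integral_of_summable_integral_norm hint hsum
  have h1 : ∀ n, ∫ u in Ioc (0 : ℝ) 1, F n u =
      Complex.Gamma p * Complex.Gamma q * (kummerCoeff p (p + q) n * z ^ n) := fun n => by
    calc ∫ u in Ioc (0 : ℝ) 1, F n u = ∫ u in Ioc (0 : ℝ) 1, z ^ n / n.factorial *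
          ((u : ℂ) ^ (p - 1) * (1 - (u : ℂ)) ^ (q - 1) * (u : ℂ) ^ n) := by
          congr 1
          funext u
          simp only [hF]
          ring
      _ = _ := by
          rw [integral_const_mul, integral_beta_kernel_mul_pow hp hq, kummerCoeff]
          ring
  simp only [h1] at h
  rw [kummerM, ← tsum_mul_left, h.tsum_eq]
  congr 1
  funext u
  simp only [hF]
  rw [tsum_mul_left, Complex.exp_eq_exp_ℂ, NormedSpace.exp_eq_tsum_div]

theorem polyBdd_kummerM_of_re_pos {a c : ℂ} (ha : 0 < a.re) (hc : 0 < (c - a).re) :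
    PolyBdd (kummerM a c) := by
  have hg : Complex.Gamma a * Complex.Gamma (c - a) ≠ 0 :=
    mul_ne_zero (Complex.Gamma_ne_zero_of_re_pos ha) (Complex.Gamma_ne_zero_of_re_pos hc)
  have hk := integrableOn_beta_kernel ha hc
  refine ⟨‖(Complex.Gamma a * Complex.Gamma (c - a))⁻¹‖ *
    ∫ u in Ioc (0 : ℝ) 1, ‖(u : ℂ) ^ (a - 1) * (1 - (u : ℂ)) ^ (c - a - 1)‖, 0, fun z hz => ?_⟩
  have h := integral_beta_kernel_mul_exp ha hc z
  rw [add_sub_cancel] at h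
  rw [← inv_mul_cancel_left₀ hg (kummerM a c z), ← h, norm_mul, pow_zero, mul_one]
  gcongr
  refine norm_integral_le_of_norm_le hk.norm ?_
  filter_upwards [ae_restrict_mem measurableSet_Ioc] with u hu
  rw [norm_mul]
  refine mul_le_of_le_one_right (norm_nonneg _) ?_
  rw [Complex.norm_exp, Real.exp_le_one_iff]
  simp
  nlinarith [hu.1]

theorem polyBdd_kummerM (a c : ℂ) : PolyBdd (kummerM a c) := by
  have h1 : ∀ (m : ℕ) (a c : ℂ), 0 < a.re → 0 < (c - a).re + m → PolyBdd (kummerM a c) := by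
    intro m
    induction m with
    | zero => exact fun a c ha hc => polyBdd_kummerM_of_re_pos ha (by simpa using hc)
    | succ m ih =>
      intro a c ha hc
      rw [show kummerM a c = fun z => c * kummerM a (c + 1) z + a * z * kummerM (a + 1) (c + 2) z
        from funext (kummerM_raise_den a c)]
      push_cast at hc
      simp only [Complex.sub_re] at hc
      refine PolyBdd.add ((PolyBdd.const c).mul (ih _ _ ha ?_))
        (((PolyBdd.const a).mul PolyBdd.id).mul (ih _ _ ?_ ?_)) <;> simp <;> linarith
  have h2 : ∀ (m : ℕ) (a c : ℂ), 0 < a.re + m → PolyBdd (kummerM a c) := by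
    intro m
    induction m with
    | zero =>
      intro a c ha
      obtain ⟨k, hk⟩ := exists_nat_gt (-(c - a).re)
      exact h1 k a c (by simpa using ha) (by linarith)
    | succ m ih =>
      intro a c ha
      rw [show kummerM a c = fun z => kummerM (a + 1) c z + (-1) * z * kummerM (a + 1) (c + 1) z
        from funext fun z => by rw [kummerM_raise_num a c]; ring]
      push_cast at ha
      refine PolyBdd.add (ih _ _ ?_) (((PolyBdd.const (-1)).mul PolyBdd.id).mul (ih _ _ ?_)) <;>
        simp <;> linarith
  obtain ⟨k, hk⟩ := exists_nat_gt (-a.re)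
  exact h2 k a c (by linarith)

theorem laplaceT_kummerM_lower_num {a b s : ℂ} (hb : 0 < b.re) (hs : 0 < s.re) :
    laplaceT b s (kummerM a (1 + a - b)) =
      (a + 1) * (a + 2 - 2 * b) * laplaceT b s (kummerM (a + 2) (1 + (a + 2) - b)) := by
  set c := 1 + a - b with hc
  have hd := laplaceT_deriv hb hs
    (f := fun w => (-1) * kummerM (a + 1) (c + 1) w + (a + 1) * kummerM (a + 2) (c + 2) w)
    (f' := fun w => -(a + 1) * kummerM (a + 2) (c + 2) w +
      (a + 1) * (a + 2) * kummerM (a + 3) (c + 3) w)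
    (fun z => by
      refine (((hasDerivAt_kummerM (a + 1) (c + 1) z).const_mul (-1)).add
        ((hasDerivAt_kummerM (a + 2) (c + 2) z).const_mul (a + 1))).congr_deriv ?_
      rw [show a + 1 + 1 = a + 2 by ring, show c + 1 + 1 = c + 2 by ring,
        show a + 2 + 1 = a + 3 by ring, show c + 2 + 1 = c + 3 by ring]
      ring)
    (((PolyBdd.const _).mul (polyBdd_kummerM _ _)).add
      ((PolyBdd.const _).mul (polyBdd_kummerM _ _)))
    (by have := continuous_kummerM; fun_prop)
    (((PolyBdd.const _).mul (polyBdd_kummerM _ _)).add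
      ((PolyBdd.const _).mul (polyBdd_kummerM _ _)))
  have he : ∀ w,
      (b + w) * ((-1) * kummerM (a + 1) (c + 1) w + (a + 1) * kummerM (a + 2) (c + 2) w) +
      w * (-(a + 1) * kummerM (a + 2) (c + 2) w + (a + 1) * (a + 2) * kummerM (a + 3) (c + 3) w)
      = 1 * kummerM a c w + -((a + 1) * (a + 2 - 2 * b)) * kummerM (a + 2) (c + 2) w := by
    intro w
    have e1 := kummerM_raise_both a c w
    have e2 := kummerM_raise_both (a + 1) (c + 1) w
    rw [show a + 1 + 1 = a + 2 by ring, show c + 1 + 1 = c + 2 by ring,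
      show a + 1 + 2 = a + 3 by ring, show c + 1 + 2 = c + 3 by ring] at e2
    rw [hc] at *
    linear_combination -e1 - (a + 1) * e2
  simp only [he] at hd
  rw [laplaceT_lin hb hs _ _ (continuous_kummerM _ _) (polyBdd_kummerM _ _)
    (continuous_kummerM _ _) (polyBdd_kummerM _ _)] at hd
  rw [show 1 + (a + 2) - b = c + 2 by rw [hc]; ring]
  linear_combination hd

theorem laplaceT_kummerM_raise_exponent {a b s : ℂ} (hb : 0 < b.re) (hs : 0 < s.re) :
    s * laplaceT (b + 1) s (kummerM a (1 + a - (b + 1))) =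
      b * (a / 2 - b) * laplaceT b s (kummerM a (1 + a - b)) := by
  set c := 1 + a - b with hc
  have hd := laplaceT_deriv hb hs
    (f := fun w => (b - a / 2) * kummerM a c w + -(a / 2) * w * kummerM (a + 1) (c + 1) w)
    (f' := fun w => ((b - a / 2) * a - a / 2) * kummerM (a + 1) (c + 1) w +
      -(a / 2) * (a + 1) * w * kummerM (a + 2) (c + 2) w)
    (fun z => by
      refine (((hasDerivAt_kummerM a c z).const_mul (b - a / 2)).add
        (((hasDerivAt_id z).const_mul (-(a / 2))).mul
          (hasDerivAt_kummerM (a + 1) (c + 1) z))).congr_deriv ?_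
      rw [show a + 1 + 1 = a + 2 by ring, show c + 1 + 1 = c + 2 by ring]
      simp only [id]
      ring)
    (((PolyBdd.const _).mul (polyBdd_kummerM _ _)).add
      (((PolyBdd.const _).mul PolyBdd.id).mul (polyBdd_kummerM _ _)))
    (by have := continuous_kummerM; fun_prop)
    (((PolyBdd.const _).mul (polyBdd_kummerM _ _)).add
      (((PolyBdd.const _).mul PolyBdd.id).mul (polyBdd_kummerM _ _)))
  have he : ∀ w, (b + w) * ((b - a / 2) * kummerM a c w +
        -(a / 2) * w * kummerM (a + 1) (c + 1) w) +
      w * (((b - a / 2) * a - a / 2) * kummerM (a + 1) (c + 1) w +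
        -(a / 2) * (a + 1) * w * kummerM (a + 2) (c + 2) w)
      = (-1) * (w * kummerM a (c - 1) w) + -(b * (a / 2 - b)) * kummerM a c w := by
    intro w
    have e1 := kummerM_raise_both a c w
    have e2 := kummerM_raise_den a (c - 1) w
    rw [show c - 1 + 1 = c by ring, show c - 1 + 2 = c + 1 by ring] at e2
    rw [hc] at *
    linear_combination w * e2 + w * a / 2 * e1
  simp only [he] at hd
  have hcont := continuous_kummerM
  rw [laplaceT_lin hb hs _ _ (by fun_prop) (PolyBdd.id.mul (polyBdd_kummerM _ _))
    (continuous_kummerM _ _) (polyBdd_kummerM _ _), laplaceT_id_mul] at hd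
  rw [show 1 + a - (b + 1) = c - 1 by rw [hc]; ring]
  linear_combination hd

theorem hasDerivAt_laplaceT_one {b s : ℂ} (hb : 0 < b.re) (hs : 0 < s.re) :
    HasDerivAt (fun r => laplaceT b r fun _ => 1) (-laplaceT (b + 1) s fun _ => 1) s := by
  have hσ : 0 < s.re / 2 := by positivity
  have hb1 : 0 < (b + 1).re := by simp; linarith
  have h := (hasDerivAt_integral_of_dominated_loc_of_deriv_le (𝕜 := ℂ)
    (μ := volume.restrict (Ioi (0 : ℝ))) (x₀ := s) (s := Metric.ball s (s.re / 2))
    (F := fun r (t : ℝ) => Complex.exp (-(r * t)) * (t : ℂ) ^ (b - 1) * 1)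
    (F' := fun r (t : ℝ) => -(Complex.exp (-(r * t)) * (t : ℂ) ^ (b + 1 - 1) * 1))
    (bound := fun t => t ^ ((b + 1).re - 1) * Real.exp (-(s.re / 2) * t))
    (Metric.ball_mem_nhds _ hσ)
    (.of_forall fun r => ((measurable_laplace_kernel b r).mul_const 1).aestronglyMeasurable)
    (integrableOn_laplace hb hs (f := fun _ => 1) continuous_const (.const 1))
    ((measurable_laplace_kernel (b + 1) s).mul_const 1).neg.aestronglyMeasurable
    ?_ (integrableOn_laplace_rpow hb1 hσ) ?_).2
  · rw [integral_neg] at h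
    exact h
  · filter_upwards [ae_restrict_mem measurableSet_Ioi] with t ht r hr
    have ht : 0 < t := ht
    rw [norm_neg, mul_one, norm_laplace_kernel ht]
    have h1 : |(r - s).re| < s.re / 2 :=
      (Complex.abs_re_le_norm _).trans_lt (by rwa [mem_ball_iff_norm] at hr)
    rw [abs_lt, Complex.sub_re] at h1
    gcongr
    linarith
  · filter_upwards [ae_restrict_mem measurableSet_Ioi] with t ht r hr
    have ht0 : (t : ℂ) ≠ 0 := by exact_mod_cast (ne_of_gt ht)
    refine (((((hasDerivAt_id r).mul_const (t : ℂ)).neg).cexp.mul_const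
      ((t : ℂ) ^ (b - 1))).mul_const 1).congr_deriv ?_
    rw [show b + 1 - 1 = b - 1 + 1 by ring, Complex.cpow_add _ _ ht0, Complex.cpow_one]
    simp only [id, Pi.neg_apply]
    ring

theorem laplaceT_one {b s : ℂ} (hb : 0 < b.re) (hs : 0 < s.re) :
    laplaceT b s (fun _ => 1) = s ^ (-b) * Complex.Gamma b := by
  have hrec : ∀ r : ℂ, 0 < r.re →
      b * laplaceT b r (fun _ => 1) = r * laplaceT (b + 1) r (fun _ => 1) := fun r hr => by
    have h := laplaceT_deriv hb hr (f := fun _ => 1) (f' := fun _ => 0)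
      (fun z => hasDerivAt_const z 1) (.const 1) continuous_const (.const 0)
    simp only [mul_one, mul_zero, add_zero] at h
    have h2 := laplaceT_lin hb hr (f := fun _ => 1) (g := fun w => w * 1) b 1 continuous_const
      (.const 1) (by fun_prop) (PolyBdd.id.mul (.const 1))
    rw [laplaceT_id_mul] at h2
    simp only [mul_one, one_mul] at h2
    rw [h2] at h
    linear_combination h
  have hopen : IsOpen {r : ℂ | 0 < r.re} := isOpen_lt continuous_const Complex.continuous_re
  have hne : ∀ r : ℂ, 0 < r.re → r ≠ 0 := fun r hr h => by simp [h] at hr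
  have hder : ∀ r : ℂ, 0 < r.re →
      HasDerivAt (fun r => r ^ b * laplaceT b r fun _ => 1) 0 r := fun r hr => by
    refine (((hasDerivAt_id r).cpow_const (c := b) (Or.inl hr)).mul
      (hasDerivAt_laplaceT_one hb hr)).congr_deriv ?_
    simp only [id]
    rw [Complex.cpow_sub _ _ (hne r hr), Complex.cpow_one, mul_one]
    field_simp [hne r hr]
    linear_combination r ^ b * hrec r hr
  have h1 := hopen.is_const_of_deriv_eq_zero (convex_halfSpace_re_gt 0).isPreconnected
    (fun r hr => (hder r hr).differentiableAt.differentiableWithinAt)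
    (fun r hr => (hder r hr).deriv) (x := s) (y := 1) hs (by simp)
  have h2 : laplaceT b 1 (fun _ => 1) = Complex.Gamma b := by
    rw [Complex.Gamma_eq_integral hb, Complex.GammaIntegral, laplaceT]
    simp
  simp only [h2, Complex.one_cpow, one_mul] at h1
  rw [← h1, ← mul_assoc, ← Complex.cpow_add _ _ (hne s hs)]
  simp

theorem laplaceT_exp_mul {b s : ℂ} (hb : 0 < b.re) (hs : 0 < s.re) {u : ℝ} (hu : 0 ≤ u) :
    laplaceT b s (fun w => Complex.exp (w * u)) =
      s ^ (-b) * Complex.Gamma b * (1 + (u : ℂ)) ^ (-b) := by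
  have hu1 : 0 < 1 + u := by linarith
  have hs0 : s ≠ 0 := fun h => by simp [h] at hs
  have h := laplaceT_one (b := b) (s := ((1 + u : ℝ) : ℂ) * s) hb
    (by rw [Complex.re_ofReal_mul]; positivity)
  have hu0 : (((1 + u : ℝ) : ℝ) : ℂ) ≠ 0 := by exact_mod_cast hu1.ne'
  rw [Complex.cpow_def_of_ne_zero (mul_ne_zero hu0 hs0), Complex.log_ofReal_mul hu1 hs0,
    Complex.ofReal_log hu1.le, add_mul, Complex.exp_add, ← Complex.cpow_def_of_ne_zero hu0,
    ← Complex.cpow_def_of_ne_zero hs0] at h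
  push_cast at h
  calc _ = _ := by
        rw [laplaceT, laplaceT]
        congr 1
        funext t
        rw [mul_one, mul_right_comm, ← Complex.exp_add]
        congr 2
        ring
    _ = _ := h
    _ = _ := by ring

theorem laplaceT_kummerM_eq_integral {b s p q : ℂ} (hb : 0 < b.re) (hs : 0 < s.re)
    (hp : 0 < p.re) (hq : 0 < q.re) :
    Complex.Gamma p * Complex.Gamma q * laplaceT b s (kummerM p (p + q)) =
      s ^ (-b) * Complex.Gamma b * ∫ u in Ioc (0 : ℝ) 1,
        (u : ℂ) ^ (p - 1) * (1 - (u : ℂ)) ^ (q - 1) * (1 + (u : ℂ)) ^ (-b) := by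
  have hF : Integrable (Function.uncurry fun t u : ℝ =>
      (Complex.exp (-(s * t)) * (t : ℂ) ^ (b - 1)) *
        ((u : ℂ) ^ (p - 1) * (1 - (u : ℂ)) ^ (q - 1)) * Complex.exp (-(s * t) * u))
      ((volume.restrict (Ioi (0 : ℝ))).prod (volume.restrict (Ioc (0 : ℝ) 1))) := by
    have h1 : IntegrableOn (fun t : ℝ => Complex.exp (-(s * t)) * (t : ℂ) ^ (b - 1)) (Ioi 0) := by
      simpa using integrableOn_laplace hb hs (f := fun _ => 1) continuous_const (.const 1)
    refine (Integrable.mul_prod h1 (integrableOn_beta_kernel hp hq)).mul_bdd (c := 1)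
      (Continuous.aestronglyMeasurable (by fun_prop)) ?_
    rw [Measure.prod_restrict]
    filter_upwards [ae_restrict_mem (measurableSet_Ioi.prod measurableSet_Ioc)] with x hx
    have hx1 : 0 < x.1 := hx.1
    have hx2 : 0 < x.2 := hx.2.1
    rw [Complex.norm_exp, Real.exp_le_one_iff]
    simp
    positivity
  calc _ = ∫ t in Ioi (0 : ℝ), ∫ u in Ioc (0 : ℝ) 1,
        (Complex.exp (-(s * t)) * (t : ℂ) ^ (b - 1)) *
        ((u : ℂ) ^ (p - 1) * (1 - (u : ℂ)) ^ (q - 1)) * Complex.exp (-(s * t) * u) := by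
        rw [laplaceT, ← integral_const_mul]
        congr 1
        funext t
        simp only [mul_assoc (Complex.exp (-(s * t)) * (t : ℂ) ^ (b - 1))]
        rw [integral_const_mul, integral_beta_kernel_mul_exp hp hq]
        ring
    _ = ∫ u in Ioc (0 : ℝ) 1, ∫ t in Ioi (0 : ℝ),
        (Complex.exp (-(s * t)) * (t : ℂ) ^ (b - 1)) *
        ((u : ℂ) ^ (p - 1) * (1 - (u : ℂ)) ^ (q - 1)) * Complex.exp (-(s * t) * u) :=
        integral_integral_swap hF
    _ = _ := by
        rw [← integral_const_mul]
        refine setIntegral_congr_fun measurableSet_Ioc fun u hu => ?_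
        simp only [mul_right_comm _ ((u : ℂ) ^ (p - 1) * (1 - (u : ℂ)) ^ (q - 1))]
        rw [integral_mul_const]
        have := laplaceT_exp_mul hb hs hu.1.le
        rw [laplaceT] at this
        rw [this]
        ring

theorem integral_kummer_kernel_reduce {a b : ℂ} (ha : 0 < a.re) (hb : b.re < 2) :
    (1 + a - b) * (∫ u in Ioc (0 : ℝ) 1,
        (u : ℂ) ^ (a - 1) * (1 - (u : ℂ)) ^ (2 - b - 1) * (1 + (u : ℂ)) ^ (-b)) -
      b * (∫ u in Ioc (0 : ℝ) 1,
        (u : ℂ) ^ (a + 1 - 1) * (1 - (u : ℂ)) ^ (2 - b - 1) * (1 + (u : ℂ)) ^ (-(b + 1))) =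
      (a / 2 + 1 - b) * ∫ u in Ioc (0 : ℝ) 1,
        (u : ℂ) ^ (a - 1) * (1 - (u : ℂ)) ^ (2 - b - 1) * (1 + (u : ℂ)) ^ (2 - b - 1) := by
  have hq : 0 < (2 - b).re := by simpa using hb
  have ha1 : 0 < (a + 1).re := by simp; linarith
  have ha0 : a ≠ 0 := fun h => by simp [h] at ha
  have hq0 : 2 - b ≠ 0 := fun h => by simp [h] at hq
  have hslit : ∀ u : ℝ, 0 ≤ u → 1 + (u : ℂ) ∈ slitPlane := fun u hu => by
    left
    simp
    linarith
  have hcont : ∀ e : ℂ, ContinuousOn (fun u : ℝ => (1 + (u : ℂ)) ^ e) (Icc 0 1) := fun e u hu =>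
    (ContinuousAt.cpow (f := fun u : ℝ => 1 + (u : ℂ)) (by fun_prop) continuousAt_const
      (hslit u hu.1)).continuousWithinAt
  have i1 := integrableOn_beta_kernel_mul ha hq (hcont (-b))
  have i2 := integrableOn_beta_kernel_mul ha1 hq (hcont (-(b + 1)))
  have i3 := integrableOn_beta_kernel_mul ha hq (hcont (2 - b - 1))
  have hG := intervalIntegral.integral_eq_sub_of_hasDerivAt_of_le
    (f := fun u : ℝ => (u : ℂ) ^ a * (1 - (u : ℂ)) ^ (2 - b) * (1 + (u : ℂ)) ^ (-b) / 2)
    zero_le_one ?_ ?_ ((intervalIntegrable_iff_integrableOn_Ioc_of_le zero_le_one).mpr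
      (((i1.const_mul (1 + a - b)).sub (i2.const_mul b)).sub (i3.const_mul (a / 2 + 1 - b))))
  · rw [intervalIntegral.integral_of_le zero_le_one] at hG
    have hI := integral_sub ((i1.const_mul (1 + a - b)).sub (i2.const_mul b))
      (i3.const_mul (a / 2 + 1 - b))
    simp only [Pi.sub_apply] at hG hI
    rw [hI,
      integral_sub (i1.const_mul _) (i2.const_mul _), integral_const_mul, integral_const_mul,
      integral_const_mul] at hG
    simp only [Complex.ofReal_one, Complex.ofReal_zero, sub_self, Complex.zero_cpow ha0,
      Complex.zero_cpow hq0, mul_zero, zero_mul, zero_div] at hG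
    linear_combination hG
  · refine ContinuousOn.div_const (ContinuousOn.mul (Continuous.continuousOn ?_) (hcont _)) _
    have h1 : Continuous fun u : ℝ => (u : ℂ) ^ a :=
      Complex.continuous_ofReal_cpow_const ha
    have h2 : Continuous fun u : ℝ => (((1 - u : ℝ)) : ℂ) ^ (2 - b) :=
      (Complex.continuous_ofReal_cpow_const hq).comp (by fun_prop)
    push_cast at h2
    exact h1.mul h2
  · intro u hu
    have hu0 : (u : ℂ) ≠ 0 := by exact_mod_cast (ne_of_gt hu.1)
    have hu1 : 1 - (u : ℂ) ≠ 0 := by exact_mod_cast (ne_of_gt (sub_pos.mpr hu.2))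
    have hu2 : 1 + (u : ℂ) ≠ 0 := slitPlane_ne_zero (hslit u hu.1.le)
    have d0 : HasDerivAt (fun u : ℝ => (u : ℂ)) 1 u := Complex.ofRealCLM.hasDerivAt
    have d1 := (Complex.hasStrictDerivAt_cpow_const (c := a)
      (Or.inl hu.1 : (u : ℂ) ∈ slitPlane)).hasDerivAt.comp u d0
    have d2 := (Complex.hasStrictDerivAt_cpow_const (c := 2 - b)
      (Or.inl (by simpa using hu.2) : 1 - (u : ℂ) ∈ slitPlane)).hasDerivAt.comp u (d0.const_sub 1)
    have d3 := (Complex.hasStrictDerivAt_cpow_const (c := -b)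
      (hslit u hu.1.le)).hasDerivAt.comp u (d0.const_add 1)
    refine (((d1.mul d2).mul d3).div_const 2).congr_deriv ?_
    simp only [Pi.mul_apply, Pi.sub_apply, Function.comp_apply]
    have hpow : ∀ x e : ℂ, x ≠ 0 → x ^ e = x ^ (e - 1) * x := fun x e hx => by
      rw [Complex.cpow_sub _ _ hx, Complex.cpow_one, div_mul_cancel₀ _ hx]
    have e1 := hpow _ a hu0
    have e2 := hpow _ (2 - b) hu1
    have e3 := hpow _ (-b) hu2
    have e4 : (1 + (u : ℂ)) ^ (2 - b - 1) = (1 + (u : ℂ)) ^ (-b - 1) * (1 + u) * (1 + u) := by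
      rw [← e3, show 2 - b - 1 = -b + 1 by ring, Complex.cpow_add _ _ hu2, Complex.cpow_one]
    rw [e4, e3, e2, add_sub_cancel_right, e1, show -(b + 1) = -b - 1 by ring]
    ring

theorem integral_cpow_mul_one_sub_sq {a q : ℂ} (ha : 0 < a.re) (hq : 0 < q.re) :
    ∫ u in Ioc (0 : ℝ) 1, (u : ℂ) ^ (a - 1) * (1 - (u : ℂ)) ^ (q - 1) * (1 + (u : ℂ)) ^ (q - 1) =
      Complex.Gamma (a / 2) * Complex.Gamma q / (2 * Complex.Gamma (a / 2 + q)) := by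
  set k : ℝ → ℂ := fun x => (x : ℂ) ^ (a / 2 - 1) * (1 - (x : ℂ)) ^ (q - 1) with hk
  have h := integral_comp_rpow_Ioi_of_pos (g := (Ioc (0 : ℝ) 1).indicator k) two_pos
  have ha2 : 0 < (a / 2).re := by
    rw [show a / 2 = ((1 / 2 : ℝ) : ℂ) * a by push_cast; ring, Complex.re_ofReal_mul]
    positivity
  rw [setIntegral_indicator measurableSet_Ioc, inter_eq_right.mpr Ioc_subset_Ioi_self] at h
  have hB : ∫ x in Ioc (0 : ℝ) 1, k x = Complex.betaIntegral (a / 2) q := by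
    rw [Complex.betaIntegral, intervalIntegral.integral_of_le zero_le_one]
  rw [hB, Complex.betaIntegral_eq_Gamma_mul_div _ _ ha2 hq] at h
  have h2 : ∫ x in Ioi (0 : ℝ), ((2 : ℝ) * x ^ ((2 : ℝ) - 1)) •
      (Ioc (0 : ℝ) 1).indicator k (x ^ (2 : ℝ)) =
      ∫ x in Ioi (0 : ℝ), (Ioc (0 : ℝ) 1).indicator (fun u : ℝ => 2 *
        ((u : ℂ) ^ (a - 1) * (1 - (u : ℂ)) ^ (q - 1) * (1 + (u : ℂ)) ^ (q - 1))) x := by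
    refine setIntegral_congr_fun measurableSet_Ioi fun u hu => ?_
    have hu : 0 < u := hu
    have hu0 : (u : ℂ) ≠ 0 := by exact_mod_cast hu.ne'
    simp only [Real.rpow_two]
    by_cases hu1 : u ≤ 1
    · rw [indicator_of_mem (show u ^ 2 ∈ Ioc (0 : ℝ) 1 from
        ⟨by positivity, pow_le_one₀ hu.le hu1⟩), indicator_of_mem (show u ∈ Ioc (0 : ℝ) 1 from
        ⟨hu, hu1⟩), hk, Complex.real_smul]
      have e1 : ((u ^ 2 : ℝ) : ℂ) ^ (a / 2 - 1) * u = (u : ℂ) ^ (a - 1) := by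
        rw [pow_two, Complex.ofReal_mul, Complex.mul_cpow_ofReal_nonneg hu.le hu.le,
          ← Complex.cpow_add _ _ hu0]
        nth_rw 2 [← Complex.cpow_one (u : ℂ)]
        rw [← Complex.cpow_add _ _ hu0]
        congr 1
        ring
      have e2 : (1 - ((u ^ 2 : ℝ) : ℂ)) ^ (q - 1) =
          (1 - (u : ℂ)) ^ (q - 1) * (1 + (u : ℂ)) ^ (q - 1) := by
        have := Complex.mul_cpow_ofReal_nonneg (sub_nonneg.mpr hu1)
          (show 0 ≤ 1 + u by linarith) (q - 1)
        push_cast at this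
        rw [← this]
        congr 1
        push_cast
        ring
      simp only
      rw [e2, ← e1, show (2 : ℝ) - 1 = 1 by norm_num, Real.rpow_one]
      push_cast
      ring
    · rw [indicator_of_notMem (fun h => hu1 ((pow_le_one_iff_of_nonneg hu.le two_ne_zero).mp h.2)),
        indicator_of_notMem (fun h => hu1 h.2), smul_zero]
  rw [h2, setIntegral_indicator measurableSet_Ioc, inter_eq_right.mpr Ioc_subset_Ioi_self,
    integral_const_mul] at h
  rw [mul_comm (2 : ℂ) (Complex.Gamma _), ← div_div, ← h]
  ring

/-- The value of the Laplace transform of `kummerM a (1 + a - b)`, a form of Kummer's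
summation theorem. -/
noncomputable def kummerValue (a b s : ℂ) : ℂ :=
  s ^ (-b) * Complex.Gamma (1 / 2) * Complex.Gamma b * ((2 : ℂ) ^ a)⁻¹ *
    ((Complex.Gamma ((a + 1) / 2))⁻¹ * (Complex.Gamma (1 + a / 2 - b))⁻¹)

theorem Gamma_inv_eq (z : ℂ) : (Complex.Gamma z)⁻¹ = z * (Complex.Gamma (z + 1))⁻¹ := by
  simpa using Complex.one_div_Gamma_eq_self_mul_one_div_Gamma_add_one z

theorem laplaceT_kummerM_of_re_lt {a b s : ℂ} (ha : 0 < a.re) (hb : 0 < b.re) (hb2 : b.re < 2)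
    (hs : 0 < s.re) : laplaceT b s (kummerM a (1 + a - b)) = kummerValue a b s := by
  have hq : 0 < (2 - b).re := by simpa using hb2
  have ha1 : 0 < (a + 1).re := by simp; linarith
  have hb1 : 0 < (b + 1).re := by simp; linarith
  have ha0 : a ≠ 0 := fun h => by simp [h] at ha
  have hb0 : b ≠ 0 := fun h => by simp [h] at hb
  have hs0 : s ≠ 0 := fun h => by simp [h] at hs
  have hGa := Complex.Gamma_ne_zero_of_re_pos ha
  have hGq := Complex.Gamma_ne_zero_of_re_pos hq
  have hGh : Complex.Gamma ((a + 1) / 2) ≠ 0 := by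
    refine Complex.Gamma_ne_zero_of_re_pos ?_
    rw [show (a + 1) / 2 = ((1 / 2 : ℝ) : ℂ) * (a + 1) by push_cast; ring, Complex.re_ofReal_mul]
    positivity
  have hJ : laplaceT b s (kummerM a (1 + a - b)) =
      (1 + a - b) * laplaceT b s (kummerM a (a + (2 - b))) +
      a * (-s * laplaceT (b + 1) s (kummerM (a + 1) (a + 1 + (2 - b)))) := by
    rw [← laplaceT_id_mul, ← laplaceT_lin hb hs _ _ (continuous_kummerM _ _)
      (polyBdd_kummerM _ _) (by have := continuous_kummerM; fun_prop)
      (PolyBdd.id.mul (polyBdd_kummerM _ _))]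
    congr 1
    funext w
    rw [kummerM_raise_den, show 1 + a - b + 1 = a + (2 - b) by ring,
      show 1 + a - b + 2 = a + 1 + (2 - b) by ring]
    ring
  have h1 := laplaceT_kummerM_eq_integral hb hs ha hq
  have h2 := laplaceT_kummerM_eq_integral hb1 hs ha1 hq
  have h3 := integral_kummer_kernel_reduce ha hb2
  rw [integral_cpow_mul_one_sub_sq ha hq] at h3
  have hsp : s ^ (-(b + 1)) * s = s ^ (-b) := by
    rw [show -(b + 1) = -b - 1 by ring, Complex.cpow_sub _ _ hs0, Complex.cpow_one,
      div_mul_cancel₀ _ hs0]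
  have hd := Complex.Gamma_mul_Gamma_add_half (a / 2)
  rw [show a / 2 + 1 / 2 = (a + 1) / 2 by ring, show 2 * (a / 2) = a by ring,
    Complex.cpow_sub _ _ two_ne_zero, Complex.cpow_one] at hd
  have hG := Gamma_inv_eq (1 + a / 2 - b)
  rw [Complex.Gamma_add_one _ ha0, Complex.Gamma_add_one _ hb0] at h2
  have hpi : Complex.Gamma (1 / 2) = (√Real.pi : ℝ) := by
    rw [show (1 / 2 : ℂ) = ((1 / 2 : ℝ) : ℂ) by push_cast; rfl, Complex.Gamma_ofReal,
      Real.Gamma_one_half_eq]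
  rw [← hpi] at hd
  rw [show 1 + a / 2 - b + 1 = a / 2 + (2 - b) by ring] at hG
  refine mul_left_cancel₀ (mul_ne_zero hGa hGq) ?_
  have h4 : Complex.Gamma a * Complex.Gamma (2 - b) * laplaceT b s (kummerM a (1 + a - b)) =
      s ^ (-b) * Complex.Gamma b * ((a / 2 + 1 - b) * (Complex.Gamma (a / 2) *
        Complex.Gamma (2 - b) / (2 * Complex.Gamma (a / 2 + (2 - b))))) := by
    rw [hJ, ← h3, ← hsp]
    rw [← hsp] at h1
    linear_combination (1 + a - b) * h1 - s * h2
  rw [h4, kummerValue, hG]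
  have hd' : Complex.Gamma (a / 2) = Complex.Gamma a * (2 / 2 ^ a) * Complex.Gamma (1 / 2) *
      (Complex.Gamma ((a + 1) / 2))⁻¹ := by
    rw [← hd, mul_inv_cancel_right₀ hGh]
  rw [hd']
  simp only [div_eq_mul_inv, mul_inv]
  ring

theorem kummerValue_lower_num (a b s : ℂ) :
    kummerValue a b s = (a + 1) * (a + 2 - 2 * b) * kummerValue (a + 2) b s := by
  have h1 := Gamma_inv_eq ((a + 1) / 2)
  have h2 := Gamma_inv_eq (1 + a / 2 - b)
  rw [kummerValue, kummerValue, h1, h2, show (a + 1) / 2 + 1 = (a + 2 + 1) / 2 by ring,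
    show 1 + a / 2 - b + 1 = 1 + (a + 2) / 2 - b by ring, Complex.cpow_add _ _ two_ne_zero,
    show (2 : ℂ) ^ (2 : ℂ) = 4 by norm_num, mul_inv]
  ring

theorem kummerValue_raise_exponent {a b s : ℂ} (hb : b ≠ 0) (hs : s ≠ 0) :
    s * kummerValue a (b + 1) s = b * (a / 2 - b) * kummerValue a b s := by
  have h2 := Gamma_inv_eq (1 + a / 2 - (b + 1))
  rw [kummerValue, kummerValue, h2, show 1 + a / 2 - (b + 1) + 1 = 1 + a / 2 - b by ring,
    Complex.Gamma_add_one _ hb, show -(b + 1) = -b - 1 by ring, Complex.cpow_sub _ _ hs,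
    Complex.cpow_one]
  field_simp
  ring

theorem laplaceT_kummerM {a b s : ℂ} (hb : 0 < b.re) (hs : 0 < s.re) :
    laplaceT b s (kummerM a (1 + a - b)) = kummerValue a b s := by
  have h1 : ∀ (m : ℕ) (a b : ℂ), 0 < b.re → b.re < 2 → 0 < a.re + m →
      laplaceT b s (kummerM a (1 + a - b)) = kummerValue a b s := by
    intro m
    induction m with
    | zero => exact fun a b hb hb2 ha => laplaceT_kummerM_of_re_lt (by simpa using ha) hb hb2 hs
    | succ m ih =>
      intro a b hb hb2 ha
      rw [laplaceT_kummerM_lower_num hb hs, kummerValue_lower_num, ih (a + 2) b hb hb2]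
      push_cast at ha
      simp
      linarith
  have h2 : ∀ (m : ℕ) (b : ℂ), 0 < b.re → b.re < m + 2 →
      laplaceT b s (kummerM a (1 + a - b)) = kummerValue a b s := by
    intro m
    induction m with
    | zero =>
      intro b hb hb2
      obtain ⟨k, hk⟩ := exists_nat_gt (-a.re)
      exact h1 k a b hb (by simpa using hb2) (by linarith)
    | succ m ih =>
      intro b hb hb2
      rcases lt_or_ge b.re 2 with h | h
      · obtain ⟨k, hk⟩ := exists_nat_gt (-a.re)
        exact h1 k a b hb h (by linarith)
      · have hs0 : s ≠ 0 := fun h => by simp [h] at hs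
        have hb1 : 0 < (b - 1).re := by simp; linarith
        have hb0 : b - 1 ≠ 0 := fun h => by simp [h] at hb1
        have e1 := laplaceT_kummerM_raise_exponent (a := a) hb1 hs
        have e2 := kummerValue_raise_exponent (a := a) hb0 hs0
        rw [ih (b - 1) hb1 (by push_cast at hb2; simp; linarith), ← e2, sub_add_cancel] at e1
        exact mul_left_cancel₀ hs0 e1
  obtain ⟨k, hk⟩ := exists_nat_gt b.re
  exact h2 k b hb (by linarith)

theorem hyp_eq_kummerM {a c d : ℂ} (hc : ∀ n : ℕ, c ≠ -(n : ℂ)) (hd : ∀ n : ℕ, d ≠ -(n : ℂ))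
    (z : ℂ) : hyp [a, d + 1] [c, d] z =
      Complex.Gamma c * (1 - a / d) * kummerM a c z +
        Complex.Gamma c * (a / d) * kummerM (a + 1) c z := by
  have hd0 : d ≠ 0 := by simpa using hd 0
  have hpd : ∀ n, poch d n ≠ 0 := fun n h => by
    have := Gamma_mul_poch_eq d hd n
    rw [h, mul_zero] at this
    refine Complex.Gamma_ne_zero (fun m hm => hd (n + m) ?_) this
    push_cast
    linear_combination hm
  rw [kummerM, kummerM, ← tsum_mul_left, ← tsum_mul_left,
    ← ((summable_kummerM a c z).mul_left _).tsum_add ((summable_kummerM (a + 1) c z).mul_left _),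
    hyp]
  refine tsum_congr fun n => ?_
  have hGn : Complex.Gamma (c + n) ≠ 0 := by
    refine Complex.Gamma_ne_zero fun m hm => hc (n + m) ?_
    push_cast
    linear_combination hm
  have e1 := Gamma_mul_poch_eq c hc n
  have hpc : poch c n ≠ 0 := fun h => hGn (by rw [e1, h, mul_zero])
  have e2 := poch_mul_add a n
  have e3 := poch_mul_add d n
  have hG := Complex.Gamma_ne_zero hc
  have hn : (n.factorial : ℂ) ≠ 0 := by exact_mod_cast n.factorial_ne_zero
  have hp := hpd n
  simp only [List.map_cons, List.map_nil, List.prod_cons, List.prod_nil, mul_one, kummerCoeff]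
  rw [e1]
  field_simp
  linear_combination z ^ n * poch d n * e2 - z ^ n * poch a n * e3

theorem stmt18 (a b d s : ℂ) (hb : 0 < b.re) (hd : 0 < d.re) (hs : 0 < s.re)
    (hb1 : b ≠ 1) (h₁ : (∀ n : ℕ, 2 + a - b ≠ -(n : ℂ))) (h₂ : (∀ n : ℕ, d ≠ -(n : ℂ))) :
    ∫ t in Ioi (0:ℝ), Complex.exp (-(s * t)) * (t : ℂ) ^ (b - 1) *
        hyp [a, d + 1] [2 + a - b, d] (-(s * t))
      = s ^ (-b) * Complex.Gamma (1/2) * Complex.Gamma b * Complex.Gamma (2 + a - b) / ((2 : ℂ) ^ a * (1 - b)) *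
          (((1 + a - b) / d - 1) / (Complex.Gamma (a / 2) * Complex.Gamma (a / 2 - b + 3/2)) +
            (1 - a / d) / (Complex.Gamma ((a + 1) / 2) * Complex.Gamma (1 + a / 2 - b))) := by
  have hd0 : d ≠ 0 := by simpa using h₂ 0
  have hb0 : 1 - b ≠ 0 := sub_ne_zero.mpr hb1.symm
  have hM := continuous_kummerM
  have hsplit : laplaceT b s (fun w => hyp [a, d + 1] [2 + a - b, d] w) =
      Complex.Gamma (2 + a - b) * (1 - a / d) * laplaceT b s (kummerM a (2 + a - b)) +
        Complex.Gamma (2 + a - b) * (a / d) * laplaceT b s (kummerM (a + 1) (2 + a - b)) := by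
    simp only [hyp_eq_kummerM h₁ h₂]
    exact laplaceT_lin hb hs _ _ (hM _ _) (polyBdd_kummerM _ _) (hM _ _) (polyBdd_kummerM _ _)
  have hJ := laplaceT_kummerM (a := a) hb hs
  have hJ1 := laplaceT_kummerM (a := a + 1) hb hs
  rw [show 1 + (a + 1) - b = 2 + a - b by ring] at hJ1
  have hI : (1 - b) * laplaceT b s (kummerM a (2 + a - b)) =
      kummerValue a b s - a * kummerValue (a + 1) b s := by
    rw [← hJ, ← hJ1]
    have h := laplaceT_lin hb hs (f := kummerM a (2 + a - b))
      (g := kummerM (a + 1) (2 + a - b)) (1 - b) a (hM _ _) (polyBdd_kummerM _ _) (hM _ _)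
      (polyBdd_kummerM _ _)
    rw [eq_sub_iff_add_eq, ← h]
    congr 1
    funext w
    have := kummerM_contiguous a (1 + a - b) w
    rw [show 1 + a - b + 1 = 2 + a - b by ring] at this
    linear_combination this
  have hI' : laplaceT b s (kummerM a (2 + a - b)) =
      (kummerValue a b s - a * kummerValue (a + 1) b s) / (1 - b) := by
    rw [eq_div_iff hb0, ← hI]
    ring
  have hY : a * kummerValue (a + 1) b s = s ^ (-b) * Complex.Gamma (1 / 2) * Complex.Gamma b *
      ((2 : ℂ) ^ a)⁻¹ * ((Complex.Gamma (a / 2))⁻¹ * (Complex.Gamma (a / 2 - b + 3 / 2))⁻¹) := by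
    rw [kummerValue, Gamma_inv_eq (a / 2), show a / 2 + 1 = (a + 1 + 1) / 2 by ring,
      show 1 + (a + 1) / 2 - b = a / 2 - b + 3 / 2 by ring, Complex.cpow_add _ _ two_ne_zero,
      Complex.cpow_one, mul_inv]
    ring
  change laplaceT b s (fun w => hyp [a, d + 1] [2 + a - b, d] w) = _
  rw [hsplit, hJ1, hI']
  calc _ = Complex.Gamma (2 + a - b) / (1 - b) * ((1 - a / d) * kummerValue a b s +
        ((1 + a - b) / d - 1) * (a * kummerValue (a + 1) b s)) := by
        field_simp
        ring
    _ = _ := by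
        rw [hY, kummerValue]
        simp only [div_eq_mul_inv, mul_inv]
        ring
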